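/- Let O_1 and O_2 be two (not necessarily exhaustive) sequences of crimp operations performed on a 1D crease pattern C = (c_0, …, c_n), producing crease patterns Q_1 and Q_2 respectively. Suppose indices i < j in {0, 1, …, n} are such that the corresponding points survive in both Q_1 and Q_2 and are adjacent in both (no surviving crease has index strictly between i and j in Q_1 or in Q_2). Then the distance between the points of indices i and j is the same in Q_1 as in Q_2. -/

import Mathlib

/-- Mountain or valley label for a crease. -/
inductive MV : Type
  | M : MV
  | V : MV
deriving DecidableEq

/-- `(c 0, c 1, …, c n)` is a 1D crease pattern: a strictly increasing finite
sequence of reals with `n ≥ 1`.  The points `c 1, …, c (n-1)` are its creases,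
`c 0` and `c n` its ends. -/
def IsCreasePattern (n : ℕ) (c : ℕ → ℝ) : Prop :=
  1 ≤ n ∧ ∀ i j : ℕ, i < j → j ≤ n → c i < c j

/-- The consecutive creases `(c i, …, c (i+k))` form a crimpable sequence with gap `d`. -/
def IsCrimpable (n : ℕ) (c : ℕ → ℝ) (i k : ℕ) (d : ℝ) : Prop :=
  1 ≤ i ∧ 1 ≤ k ∧ i + k ≤ n - 1 ∧
  (∀ m : ℕ, i ≤ m → m < i + k → c (m + 1) - c m = d) ∧
  d < c i - c (i - 1) ∧ d < c (i + k + 1) - c (i + k)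

/-- Additive offset of the folded-position map on the `j`-th interval:
on `[c j, c (j+1)]` the folded-position map is `x ↦ (-1)^j * x + foldOffset c j`. -/
def foldOffset (c : ℕ → ℝ) : ℕ → ℝ
  | 0 => 0
  | j + 1 => foldOffset c (j) + 2 * (-1 : ℝ) ^ j * c (j + 1)

/-- Folded position of a point `x` belonging to the `j`-th interval `[c j, c (j+1)]`.
This is the unique continuous map equal to the identity on `[c 0, c 1]`, isometric on
every interval, and reversing direction at every crease. -/
def foldPos (c : ℕ → ℝ) (j : ℕ) (x : ℝ) : ℝ := (-1 : ℝ) ^ j * x + foldOffset c j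

/-- Folded position of the crease `c i`. -/
def foldCrease (c : ℕ → ℝ) (i : ℕ) : ℝ := foldPos c i (c i)

/-- `x` lies strictly `lt`-between `a` and `b`. -/
def Between (lt : ℕ → ℕ → Prop) (a b x : ℕ) : Prop :=
  (lt a x ∧ lt x b) ∨ (lt b x ∧ lt x a)

/-- The MV pattern `(C, μ)` is flat-foldable: there is a strict linear order `lt`
("strictly below") on the intervals `I_0, …, I_{n-1}` (indexed `0, …, n-1`) such that:
(i) for each crease `i`, `I_{i-1}` is below `I_i` iff either `μ i = V` and the folded map
is increasing on `I_{i-1}` (slope `(-1)^(i-1) = 1`), or `μ i = M` and it is decreasing;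
(ii) for each crease `i` and each interval `J` whose folded image contains the folded
crease position in its interior, `J` is not strictly between `I_{i-1}` and `I_i`;
(iii) for distinct creases `i, j` folding to the same point, it is not the case that
exactly one of `I_{j-1}`, `I_j` is strictly between `I_{i-1}` and `I_i`. -/
def IsFlatFoldable (n : ℕ) (c : ℕ → ℝ) (μ : ℕ → MV) : Prop :=
  ∃ lt : ℕ → ℕ → Prop,
    (∀ j, j < n → ¬ lt j j) ∧
    (∀ a b e, lt a b → lt b e → lt a e) ∧
    (∀ a b, a < n → b < n → a ≠ b → lt a b ∨ lt b a) ∧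
    (∀ a b, lt a b → a < n ∧ b < n) ∧
    (∀ i, 1 ≤ i → i ≤ n - 1 →
      (lt (i - 1) i ↔ ((μ i = MV.V ∧ Even (i - 1)) ∨ (μ i = MV.M ∧ Odd (i - 1))))) ∧
    (∀ i, 1 ≤ i → i ≤ n - 1 → ∀ j, j < n →
      foldCrease c i ∈
        Set.Ioo (min (foldPos c j (c j)) (foldPos c j (c (j + 1))))
                (max (foldPos c j (c j)) (foldPos c j (c (j + 1)))) →
      ¬ Between lt (i - 1) i j) ∧
    (∀ i j, 1 ≤ i → i ≤ n - 1 → 1 ≤ j → j ≤ n - 1 → i ≠ j →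
      foldCrease c i = foldCrease c j →
      (Between lt (i - 1) i (j - 1) ↔ Between lt (i - 1) i j))

/-- `F` is a forcing set for the MV pattern `(C, μ)`: a set of creases such that the only
flat-foldable assignment agreeing with `μ` on `F` is `μ` itself (on all creases). -/
def IsForcingSet (n : ℕ) (c : ℕ → ℝ) (μ : ℕ → MV) (F : Set ℕ) : Prop :=
  F ⊆ Set.Icc 1 (n - 1) ∧
  ∀ ν : ℕ → MV, IsFlatFoldable n c ν → (∀ x ∈ F, ν x = μ x) →
    ∀ x, 1 ≤ x → x ≤ n - 1 → ν x = μ x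

/-- The crease pattern produced by a monocrimp at the adjacent pair `(c j, c (j+1))`:
it deletes `c j` and `c (j+1)` and translates all later points by `-2 * (c (j+1) - c j)`. -/
def monocrimpPattern (c : ℕ → ℝ) (j : ℕ) : ℕ → ℝ :=
  fun x => if x < j then c x else c (x + 2) - 2 * (c (j + 1) - c j)

/-- A state of the folding process: the set of surviving (alive) indices of the
original crease pattern, together with the current positions of the points.
Creases keep their identity (original index) while their positions shift. -/
structure PState where
  alive : Finset ℕ
  pos : ℕ → ℝ

/-- `a` and `b` are adjacent surviving points (no survivor strictly between them). -/
def Adjacent (s : Finset ℕ) (a b : ℕ) : Prop :=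
  a ∈ s ∧ b ∈ s ∧ a < b ∧ ∀ x ∈ s, ¬ (a < x ∧ x < b)

/-- A monocrimp at the adjacent surviving pair `(a, b)`: the two neighboring intervals
are at least as long as the middle one; `a`, `b` are deleted and all later points are
translated by `-2 * (pos b - pos a)`. -/
def Monocrimp (a b : ℕ) (S T : PState) : Prop :=
  Adjacent S.alive a b ∧
  (∃ l, Adjacent S.alive l a ∧ S.pos b - S.pos a ≤ S.pos a - S.pos l) ∧
  (∃ r, Adjacent S.alive b r ∧ S.pos b - S.pos a ≤ S.pos r - S.pos b) ∧
  T.alive = S.alive \ {a, b} ∧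
  T.pos = fun x => if b < x then S.pos x - 2 * (S.pos b - S.pos a) else S.pos x

/-- The set `α` of surviving creases forms a crimpable sequence with gap `d` in state `S`:
`α` is a set of consecutive survivors, equally spaced at distance `d`, and the intervals
adjacent to its two ends are strictly longer than `d`. -/
def CrimpableIn (S : PState) (α : Finset ℕ) (d : ℝ) : Prop :=
  ∃ lo hi, lo ∈ α ∧ hi ∈ α ∧ (∀ x ∈ α, lo ≤ x ∧ x ≤ hi) ∧ 2 ≤ α.card ∧
    α ⊆ S.alive ∧
    (∀ x ∈ S.alive, lo ≤ x → x ≤ hi → x ∈ α) ∧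
    (∀ a b, a ∈ α → b ∈ α → Adjacent S.alive a b → S.pos b - S.pos a = d) ∧
    (∃ l, Adjacent S.alive l lo ∧ d < S.pos lo - S.pos l) ∧
    (∃ r, Adjacent S.alive hi r ∧ d < S.pos r - S.pos hi)

/-- A monocrimp step performed at an adjacent pair of the remaining creases of `α`. -/
def StepIn (α : Finset ℕ) (S T : PState) : Prop :=
  ∃ a b, a ∈ α ∧ b ∈ α ∧ Monocrimp a b S T

/-- A monocrimp step at an adjacent pair of remaining creases of `α` of opposite μ-value. -/
def StepInMV (μ : ℕ → MV) (α : Finset ℕ) (S T : PState) : Prop :=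
  ∃ a b, a ∈ α ∧ b ∈ α ∧ μ a ≠ μ b ∧ Monocrimp a b S T

/-- A crimp operation on the crimpable sequence `α`: a sequence of monocrimps at adjacent
pairs of the remaining creases of `α` until no crease or exactly one crease of `α` remains. -/
def CrimpOp (α : Finset ℕ) (S T : PState) : Prop :=
  (∃ d, CrimpableIn S α d) ∧
  (∃ (m : ℕ) (W : ℕ → PState), W 0 = S ∧ W m = T ∧ (∀ t, t < m → StepIn α (W t) (W (t + 1)))) ∧
  ((T.alive ∩ α).card ≤ 1)

/-- A crimp operation on `α` in which every monocrimp pair has opposite μ-values. -/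
def CrimpOpMV (μ : ℕ → MV) (α : Finset ℕ) (S T : PState) : Prop :=
  (∃ d, CrimpableIn S α d) ∧
  (∃ (m : ℕ) (W : ℕ → PState), W 0 = S ∧ W m = T ∧ (∀ t, t < m → StepInMV μ α (W t) (W (t + 1)))) ∧
  ((T.alive ∩ α).card ≤ 1)

/-- The initial state of the crease pattern `(c 0, …, c n)`. -/
def initState (n : ℕ) (c : ℕ → ℝ) : PState := ⟨Finset.range (n + 1), c⟩

/-- `S 0, …, S m` is a sequence of crimp operations performed on `(c 0, …, c n)`,
with the `t`-th crimp performed on the crimpable sequence `α t`. -/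
def CrimpSeq (n : ℕ) (c : ℕ → ℝ) (m : ℕ) (α : ℕ → Finset ℕ) (S : ℕ → PState) : Prop :=
  S 0 = initState n c ∧ ∀ t, t < m → CrimpOp (α t) (S t) (S (t + 1))

/-- Same, where every monocrimp is performed at a pair of creases of opposite μ-value. -/
def CrimpSeqMV (μ : ℕ → MV) (n : ℕ) (c : ℕ → ℝ) (m : ℕ)
    (α : ℕ → Finset ℕ) (S : ℕ → PState) : Prop :=
  S 0 = initState n c ∧ ∀ t, t < m → CrimpOpMV μ (α t) (S t) (S (t + 1))

/-- The state contains no crimpable sequence (the sequence of crimps was exhaustive). -/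
def Exhausted (S : PState) : Prop := ¬ ∃ α d, CrimpableIn S α d

/-- Alternating sum of the first `k` interval lengths of `c`. -/
def altSum (c : ℕ → ℝ) (k : ℕ) : ℝ :=
  ∑ m ∈ Finset.range k, (-1 : ℝ) ^ m * (c (m + 1) - c m)

/-- Adjacent survivors have indices of opposite parity, and their distance is, up to sign, the
alternating sum of the original interval lengths between them. -/
def AltInvariant (c : ℕ → ℝ) (S : PState) : Prop :=
  ∀ a b, Adjacent S.alive a b →
    (-1 : ℝ) ^ b = -(-1) ^ a ∧ S.pos b - S.pos a = (-1) ^ a * (altSum c b - altSum c a)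

theorem altInvariant_initState (n : ℕ) (c : ℕ → ℝ) : AltInvariant c (initState n c) := by
  rintro a b ⟨-, hb, hab, h⟩
  simp only [initState, Finset.mem_range] at hb h
  obtain rfl : b = a + 1 := by
    by_contra hne
    exact h (a + 1) (by omega) (by omega)
  refine ⟨by ring, ?_⟩
  have hsq : (-1 : ℝ) ^ a * (-1) ^ a = 1 := by simp [← mul_pow]
  simp only [initState, altSum, Finset.sum_range_succ]
  linear_combination -(c (a + 1) - c a) * hsq

theorem Monocrimp.altInvariant {c : ℕ → ℝ} {a b : ℕ} {S T : PState} (h : Monocrimp a b S T)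
    (hS : AltInvariant c S) : AltInvariant c T := by
  obtain ⟨hab, -, -, hT, hpos⟩ := h
  rintro x y ⟨hx, hy, hxy, hno⟩
  have hmem : ∀ z, z ∈ T.alive ↔ z ∈ S.alive ∧ z ≠ a ∧ z ≠ b := by simp [hT]
  have hno' : ∀ z ∈ S.alive, x < z → z < y → z = a ∨ z = b := by
    intro z hz h1 h2
    by_contra hne
    push Not at hne
    exact hno z ((hmem z).2 ⟨hz, hne⟩) ⟨h1, h2⟩
  obtain ⟨hxS, hxa, hxb⟩ := (hmem x).1 hx
  obtain ⟨hyS, hya, hyb⟩ := (hmem y).1 hy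
  have hlt := hab.2.2.1
  have hx' := hab.2.2.2 x hxS
  have hy' := hab.2.2.2 y hyS
  rw [hpos]
  rcases lt_or_gt_of_ne hya with hya | hya
  · have := hS x y ⟨hxS, hyS, hxy, fun z hz hz' => by
      rcases hno' z hz hz'.1 hz'.2 with rfl | rfl <;> omega⟩
    simpa [show ¬ b < x by omega, show ¬ b < y by omega] using this
  · rcases lt_or_gt_of_ne hxb with hxb | hxb
    · obtain ⟨p₁, d₁⟩ := hS x a ⟨hxS, hab.1, by omega, fun z hz hz' => by
        rcases hno' z hz hz'.1 (by omega) with rfl | rfl <;> omega⟩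
      obtain ⟨p₂, d₂⟩ := hS a b hab
      obtain ⟨p₃, d₃⟩ := hS b y ⟨hab.2.1, hyS, by omega, fun z hz hz' => by
        rcases hno' z hz (by omega) hz'.2 with rfl | rfl <;> omega⟩
      rw [p₂, p₁] at p₃ d₃
      rw [p₁] at d₂
      refine ⟨by linarith, ?_⟩
      simp only [show b < y by omega, show ¬ b < x by omega, if_true, if_false]
      linear_combination d₁ - d₂ + d₃
    · have := hS x y ⟨hxS, hyS, hxy, fun z hz hz' => by
        rcases hno' z hz hz'.1 hz'.2 with rfl | rfl <;> omega⟩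
      simpa [show b < x by omega, show b < y by omega] using this

theorem CrimpOp.altInvariant {c : ℕ → ℝ} {α : Finset ℕ} {S T : PState} (h : CrimpOp α S T)
    (hS : AltInvariant c S) : AltInvariant c T := by
  obtain ⟨-, ⟨m, W, rfl, rfl, hstep⟩, -⟩ := h
  have key : ∀ t ≤ m, AltInvariant c (W t) := by
    intro t
    induction t with
    | zero => exact fun _ => hS
    | succ t ih =>
      intro ht
      obtain ⟨a, b, -, -, hm⟩ := hstep t ht
      exact hm.altInvariant (ih (by omega))
  exact key m le_rfl

theorem CrimpSeq.altInvariant {n : ℕ} {c : ℕ → ℝ} {m : ℕ} {α : ℕ → Finset ℕ} {S : ℕ → PState}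
    (h : CrimpSeq n c m α S) : AltInvariant c (S m) := by
  have key : ∀ t ≤ m, AltInvariant c (S t) := by
    intro t
    induction t with
    | zero => exact fun _ => h.1 ▸ altInvariant_initState n c
    | succ t ih => exact fun ht => (h.2 t ht).altInvariant (ih (by omega))
  exact key m le_rfl

/-- Interval-distance lemma: let `O₁` and `O₂` be two (not necessarily exhaustive)
sequences of crimp operations performed on `C = (c 0, …, c n)`, producing patterns
`Q₁ = S₁ m₁` and `Q₂ = S₂ m₂`.  If the points of indices `i < j` survive in both and are
adjacent in both, then the distance between them is the same in `Q₁` as in `Q₂`. -/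
theorem interval_distance_independent (n : ℕ) (c : ℕ → ℝ) (hC : IsCreasePattern n c)
    (m₁ m₂ : ℕ) (α₁ α₂ : ℕ → Finset ℕ) (S₁ S₂ : ℕ → PState)
    (h₁ : CrimpSeq n c m₁ α₁ S₁) (h₂ : CrimpSeq n c m₂ α₂ S₂)
    (i j : ℕ) (hij : i < j) (hjn : j ≤ n)
    (hadj₁ : Adjacent (S₁ m₁).alive i j) (hadj₂ : Adjacent (S₂ m₂).alive i j) :
    (S₁ m₁).pos j - (S₁ m₁).pos i = (S₂ m₂).pos j - (S₂ m₂).pos i := by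
  rw [(h₁.altInvariant i j hadj₁).2, (h₂.altInvariant i j hadj₂).2]
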